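/- The following integral identity holds: ∫₀¹ ((1 − t/2) e^{−t/4} − 1) dt/t + ∫₁^{∞} (1 − t/2) e^{−t/4} dt/t = −γ + 2(log 2 − 1), where γ is the Euler–Mascheroni constant. Equivalently, with h(x) = x e^{x²} and hence h'(x) = (1 + 2x²) e^{x²}, one has ∫₀¹ (h'(i√t/2) − h'(0)) dt/t + ∫₁^{∞} h'(i√t/2) dt/t = Γ'(1) + 2(log 2 − 1). -/

import Mathlib

open MeasureTheory Real

open Set Filter Topology

/-- The derivative of the Gamma function at `1` as an integral. -/
lemma integral_log_mul_exp_neg_Ioi :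
    ∫ t in Ioi (0:ℝ), Real.log t * Real.exp (-t) = -eulerMascheroniConstant := by
  have h1 : HasDerivAt Complex.Gamma
      (∫ t : ℝ in Ioi 0, (t : ℂ) ^ ((1:ℂ) - 1) * (Real.log t * Real.exp (-t))) 1 := by
    refine (Complex.hasDerivAt_GammaIntegral (s := 1) (by simp)).congr_of_eventuallyEq ?_
    filter_upwards [(isOpen_lt continuous_const Complex.continuous_re).mem_nhds
      (show (0:ℝ) < (1:ℂ).re by simp)] with s hs using Complex.Gamma_eq_integral hs
  have h2 := h1.unique Complex.hasDerivAt_Gamma_one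
  have h3 : (∫ t : ℝ in Ioi 0, (t : ℂ) ^ ((1:ℂ) - 1) * (Real.log t * Real.exp (-t)))
      = ((∫ t in Ioi (0:ℝ), Real.log t * Real.exp (-t) : ℝ) : ℂ) := by
    rw [← integral_complex_ofReal]
    refine integral_congr_ae (Eventually.of_forall fun t => ?_)
    simp
  rw [h3] at h2
  exact_mod_cast h2

lemma integrableOn_log_mul_exp_neg_Ioi :
    IntegrableOn (fun t : ℝ => Real.log t * Real.exp (-t)) (Ioi 0) := by
  by_contra h
  have h1 := integral_log_mul_exp_neg_Ioi
  rw [integral_undef h] at h1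
  linarith [one_half_lt_eulerMascheroniConstant]

lemma log_mul_exp_neg_mul_eq {a t : ℝ} (ha : 0 < a) (ht : 0 < t) :
    Real.log t * Real.exp (-(a * t)) =
      Real.log (a * t) * Real.exp (-(a * t)) - Real.log a * Real.exp (-(a * t)) := by
  rw [Real.log_mul ha.ne' ht.ne']
  ring

lemma integrableOn_log_comp_mul_exp_neg_comp_mul_Ioi {a : ℝ} (ha : 0 < a) :
    IntegrableOn (fun t : ℝ => Real.log (a * t) * Real.exp (-(a * t))) (Ioi 0) := by
  simpa using (integrableOn_Ioi_comp_mul_left_iff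
    (fun t : ℝ => Real.log t * Real.exp (-t)) 0 ha).2
      (by simpa using integrableOn_log_mul_exp_neg_Ioi)

lemma integrableOn_log_mul_exp_neg_mul_Ioi {a : ℝ} (ha : 0 < a) :
    IntegrableOn (fun t : ℝ => Real.log t * Real.exp (-(a * t))) (Ioi 0) := by
  have h1 := integrableOn_log_comp_mul_exp_neg_comp_mul_Ioi ha
  have h2 : IntegrableOn (fun t : ℝ => Real.exp (-(a * t))) (Ioi 0) := by
    simpa using exp_neg_integrableOn_Ioi 0 ha
  exact (h1.sub (h2.const_mul (Real.log a))).congr_fun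
    (fun t ht => (log_mul_exp_neg_mul_eq ha ht).symm) measurableSet_Ioi

lemma integral_log_mul_exp_neg_mul_Ioi {a : ℝ} (ha : 0 < a) :
    ∫ t in Ioi (0:ℝ), Real.log t * Real.exp (-(a * t)) =
      a⁻¹ * (-eulerMascheroniConstant - Real.log a) := by
  have h1 := integrableOn_log_comp_mul_exp_neg_comp_mul_Ioi ha
  have h2 : IntegrableOn (fun t : ℝ => Real.exp (-(a * t))) (Ioi 0) := by
    simpa using exp_neg_integrableOn_Ioi 0 ha
  rw [setIntegral_congr_fun measurableSet_Ioi (fun t ht => log_mul_exp_neg_mul_eq ha ht),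
    integral_sub h1 (h2.const_mul (Real.log a)), integral_const_mul,
    integral_comp_mul_left_Ioi (fun t : ℝ => Real.log t * Real.exp (-t)) 0 ha,
    integral_comp_mul_left_Ioi (fun t : ℝ => Real.exp (-t)) 0 ha, mul_zero,
    integral_log_mul_exp_neg_Ioi, integral_exp_neg_Ioi_zero]
  simp only [smul_eq_mul]
  ring

lemma hasDerivAt_exp_neg_div_four (t : ℝ) :
    HasDerivAt (fun t : ℝ => Real.exp (-t / 4)) (-(1 / 4) * Real.exp (-t / 4)) t := by
  convert! ((hasDerivAt_id t).neg.div_const 4).exp using 1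
  simp only [id, Pi.neg_apply]
  ring

lemma abs_exp_neg_div_four_sub_one_le {t : ℝ} (ht : 0 ≤ t) :
    |Real.exp (-t / 4) - 1| ≤ t / 4 := by
  rw [abs_le]
  constructor
  · linarith [Real.add_one_le_exp (-t / 4)]
  · linarith [Real.exp_le_one_iff.2 (show -t / 4 ≤ 0 by linarith)]

lemma intervalIntegrable_torsion :
    IntervalIntegrable (fun t : ℝ => ((1 - t / 2) * Real.exp (-t / 4) - 1) / t) volume 0 1 := by
  rw [intervalIntegrable_iff_integrableOn_Ioc_of_le zero_le_one]
  refine Measure.integrableOn_of_bounded (M := 1) (by simp)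
    (Measurable.aestronglyMeasurable (by fun_prop)) ?_
  filter_upwards [ae_restrict_mem measurableSet_Ioc] with t ht
  have h1 := abs_le.1 (abs_exp_neg_div_four_sub_one_le ht.1.le)
  have h2 := Real.exp_pos (-t / 4)
  have h3 : Real.exp (-t / 4) ≤ 1 := Real.exp_le_one_iff.2 (by linarith [ht.1])
  rw [Real.norm_eq_abs, abs_div, abs_of_pos ht.1, div_le_one ht.1, abs_le]
  constructor <;> nlinarith [ht.1, ht.2]

lemma integrableOn_torsion :
    IntegrableOn (fun t : ℝ => (1 - t / 2) * Real.exp (-t / 4) / t) (Ioi 1) := by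
  have h : IntegrableOn (fun t : ℝ => (3 / 2) * Real.exp (-(1 / 4) * t)) (Ioi 1) :=
    (exp_neg_integrableOn_Ioi 1 (by norm_num : (0:ℝ) < 1 / 4)).const_mul _
  refine Integrable.mono' h (Measurable.aestronglyMeasurable (by fun_prop)) ?_
  filter_upwards [ae_restrict_mem measurableSet_Ioi] with t ht
  have ht : 1 < t := ht
  have h2 := Real.exp_pos (-t / 4)
  rw [show -(1 / 4) * t = -t / 4 by ring, Real.norm_eq_abs, abs_div, abs_mul,
    abs_of_pos h2, abs_of_pos (by linarith : 0 < t), div_le_iff₀ (by linarith)]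
  have h3 : |1 - t / 2| ≤ 3 / 2 * t := abs_le.2 ⟨by linarith, by linarith⟩
  nlinarith

lemma tendsto_log_mul_exp_sub_one :
    Tendsto (fun t : ℝ => Real.log t * (Real.exp (-t / 4) - 1)) (𝓝[>] 0) (𝓝 0) := by
  have h : Tendsto (fun t : ℝ => |t * Real.log t|) (𝓝[>] 0) (𝓝 0) := by
    have := (Real.continuous_mul_log.abs.tendsto 0).mono_left (nhdsWithin_le_nhds (s := Ioi 0))
    simpa using this
  refine squeeze_zero_norm' ?_ h
  filter_upwards [self_mem_nhdsWithin] with t ht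
  have ht : 0 < t := ht
  have h1 := abs_exp_neg_div_four_sub_one_le ht.le
  rw [Real.norm_eq_abs, abs_mul, abs_mul, abs_of_pos ht, mul_comm]
  exact mul_le_mul_of_nonneg_right (by linarith) (abs_nonneg _)

lemma tendsto_exp_neg_div_four :
    Tendsto (fun t : ℝ => Real.exp (-t / 4)) atTop (𝓝 0) :=
  Real.tendsto_exp_atBot.comp (tendsto_neg_atTop_atBot.atBot_div_const (by norm_num))

lemma tendsto_log_mul_exp_neg_div_four :
    Tendsto (fun t : ℝ => Real.log t * Real.exp (-t / 4)) atTop (𝓝 0) := by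
  have h : Tendsto (fun t : ℝ => 4 * ((t / 4) ^ 1 * Real.exp (-(t / 4)))) atTop (𝓝 (4 * 0)) :=
    ((Real.tendsto_pow_mul_exp_neg_atTop_nhds_zero 1).comp
      (tendsto_id.atTop_div_const (by norm_num : (0:ℝ) < 4))).const_mul 4
  rw [mul_zero] at h
  refine squeeze_zero_norm' ?_ h
  filter_upwards [eventually_ge_atTop 1] with t ht
  rw [Real.norm_eq_abs, abs_of_nonneg (mul_nonneg (Real.log_nonneg ht) (Real.exp_pos _).le),
    neg_div, pow_one, ← mul_assoc, mul_div_cancel₀ t (by norm_num : (4:ℝ) ≠ 0)]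
  exact mul_le_mul_of_nonneg_right (by linarith [Real.log_le_sub_one_of_pos (by linarith : 0 < t)])
    (Real.exp_pos _).le

lemma integral_torsion :
    (∫ t in (0:ℝ)..1, ((1 - t / 2) * Real.exp (-t / 4) - 1) / t) +
        ∫ t in Set.Ioi (1:ℝ), (1 - t / 2) * Real.exp (-t / 4) / t =
      -Real.eulerMascheroniConstant + 2 * (Real.log 2 - 1) := by
  set L : ℝ → ℝ := fun t => (1 / 4) * (Real.log t * Real.exp (-t / 4)) with hL
  have hcongr : ∀ t : ℝ, -t / 4 = -(1 / 4 * t) := fun t => by ring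
  have hLint : IntegrableOn L (Ioi 0) := by
    simp only [hL, hcongr]
    exact (integrableOn_log_mul_exp_neg_mul_Ioi (by norm_num)).const_mul _
  have hLval : ∫ t in Ioi (0:ℝ), L t = -eulerMascheroniConstant + 2 * Real.log 2 := by
    simp only [hL, hcongr]
    rw [integral_const_mul, integral_log_mul_exp_neg_mul_Ioi (by norm_num), one_div, Real.log_inv,
      show (4:ℝ) = 2 ^ 2 by norm_num, Real.log_pow]
    push_cast
    ring
  have hL0 : IntervalIntegrable L volume 0 1 :=
    (intervalIntegrable_iff_integrableOn_Ioc_of_le zero_le_one).2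
      (hLint.mono_set Ioc_subset_Ioi_self)
  have hL1 : IntegrableOn L (Ioi 1) := hLint.mono_set (Ioi_subset_Ioi zero_le_one)
  have hLsplit := intervalIntegral.integral_interval_add_Ioi hLint hL1
  have hA := intervalIntegral.integral_eq_sub_of_hasDerivAt_of_tendsto
    (f := fun t : ℝ => Real.log t * (Real.exp (-t / 4) - 1) + 2 * Real.exp (-t / 4))
    (f' := fun t => ((1 - t / 2) * Real.exp (-t / 4) - 1) / t - L t)
    (fa := 0 + 2 * Real.exp (-0 / 4))
    (fb := Real.log 1 * (Real.exp (-1 / 4) - 1) + 2 * Real.exp (-1 / 4)) zero_lt_one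
    (fun t ht => by
      have ht0 := ht.1.ne'
      refine (((Real.hasDerivAt_log ht0).mul ((hasDerivAt_exp_neg_div_four t).sub_const 1)).add
        ((hasDerivAt_exp_neg_div_four t).const_mul 2)).congr_deriv ?_
      simp only [hL]
      field_simp
      ring)
    (intervalIntegrable_torsion.sub hL0)
    (tendsto_log_mul_exp_sub_one.add (((by fun_prop :
      Continuous fun t : ℝ => 2 * Real.exp (-t / 4)).tendsto 0).mono_left nhdsWithin_le_nhds))
    (((((Real.hasDerivAt_log one_ne_zero).continuousAt).mul (by fun_prop)).add
      (by fun_prop)).tendsto.mono_left nhdsWithin_le_nhds)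
  have hB := integral_Ioi_of_hasDerivAt_of_tendsto' (a := 1)
    (f := fun t : ℝ => Real.log t * Real.exp (-t / 4) + 2 * Real.exp (-t / 4))
    (f' := fun t => (1 - t / 2) * Real.exp (-t / 4) / t - L t)
    (fun t ht => by
      have ht0 : t ≠ 0 := (zero_lt_one.trans_le ht).ne'
      refine (((Real.hasDerivAt_log ht0).mul (hasDerivAt_exp_neg_div_four t)).add
        ((hasDerivAt_exp_neg_div_four t).const_mul 2)).congr_deriv ?_
      simp only [hL]
      field_simp
      ring)
    (integrableOn_torsion.sub hL1)
    (tendsto_log_mul_exp_neg_div_four.add (tendsto_exp_neg_div_four.const_mul 2))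
  rw [intervalIntegral.integral_sub intervalIntegrable_torsion hL0] at hA
  rw [integral_sub integrableOn_torsion hL1] at hB
  simp only [Real.log_one, neg_zero, zero_div, Real.exp_zero] at hA hB
  linarith

lemma one_add_two_mul_sq_mul_exp_sq_apply {t : ℝ} (ht : 0 ≤ t) :
    (1 + 2 * (Complex.I * (Real.sqrt t : ℂ) / 2) ^ 2) *
      Complex.exp ((Complex.I * (Real.sqrt t : ℂ) / 2) ^ 2) =
        (((1 - t / 2) * Real.exp (-t / 4) : ℝ) : ℂ) := by
  have h : (Complex.I * (Real.sqrt t : ℂ) / 2) ^ 2 = ((-t / 4 : ℝ) : ℂ) := by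
    rw [div_pow, mul_pow, Complex.I_sq, ← Complex.ofReal_pow, Real.sq_sqrt ht]
    push_cast
    ring
  rw [h]
  push_cast
  ring

/-- `∫₀¹ ((1 - t/2) e^{-t/4} - 1) dt/t + ∫₁^∞ (1 - t/2) e^{-t/4} dt/t
= -γ + 2(log 2 - 1)`; equivalently, with `h'(x) = (1 + 2x²) e^{x²}`,
`∫₀¹ (h'(i√t/2) - h'(0)) dt/t + ∫₁^∞ h'(i√t/2) dt/t = Γ'(1) + 2(log 2 - 1)`. -/
theorem torsion_gamma_integral_identity :
    ((∫ t in (0:ℝ)..1, ((1 - t / 2) * Real.exp (-t / 4) - 1) / t) +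
        ∫ t in Set.Ioi (1:ℝ), (1 - t / 2) * Real.exp (-t / 4) / t =
      -Real.eulerMascheroniConstant + 2 * (Real.log 2 - 1)) ∧
    (∀ h' : ℂ → ℂ, (∀ x : ℂ, h' x = (1 + 2 * x ^ 2) * Complex.exp (x ^ 2)) →
      (∫ t in (0:ℝ)..1, (h' (Complex.I * (Real.sqrt t : ℂ) / 2) - h' 0) / (t : ℂ)) +
          ∫ t in Set.Ioi (1:ℝ), h' (Complex.I * (Real.sqrt t : ℂ) / 2) / (t : ℂ) =
        ((deriv Real.Gamma 1 : ℝ) : ℂ) + 2 * ((Real.log 2 : ℂ) - 1)) := by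
  refine ⟨integral_torsion, fun h' hh => ?_⟩
  have h0 : h' 0 = 1 := by simp [hh]
  have hA : (∫ t in (0:ℝ)..1, (h' (Complex.I * (Real.sqrt t : ℂ) / 2) - h' 0) / (t : ℂ)) =
      ((∫ t in (0:ℝ)..1, ((1 - t / 2) * Real.exp (-t / 4) - 1) / t : ℝ) : ℂ) := by
    rw [← intervalIntegral.integral_ofReal]
    refine intervalIntegral.integral_congr fun t ht => ?_
    rw [uIcc_of_le zero_le_one] at ht
    simp only [h0, hh, one_add_two_mul_sq_mul_exp_sq_apply ht.1]
    push_cast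
    rfl
  have hB : (∫ t in Set.Ioi (1:ℝ), h' (Complex.I * (Real.sqrt t : ℂ) / 2) / (t : ℂ)) =
      ((∫ t in Set.Ioi (1:ℝ), (1 - t / 2) * Real.exp (-t / 4) / t : ℝ) : ℂ) := by
    rw [← integral_complex_ofReal]
    refine setIntegral_congr_fun measurableSet_Ioi fun t ht => ?_
    simp only [hh, one_add_two_mul_sq_mul_exp_sq_apply (zero_le_one.trans (le_of_lt ht))]
    push_cast
    rfl
  rw [hA, hB, ← Complex.ofReal_add, integral_torsion, eulerMascheroniConstant_eq_neg_deriv]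
  push_cast
  ring
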